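/- (Boundary clustering under weak balance on complete graphs) Assume G = K_n is the complete graph on V (every pair of distinct nodes is an edge), E_neg is nonempty, p_ij + p_ji > 0 for every {i,j} ∈ E, and G is weakly balanced under the partition V = V₁ ∪ … ∪ V_m with m ≥ 2, with each induced subgraph G_{V_j} connected. Fix α ∈ (0,1) with α ≠ 1/2. Then there exists β₀ > 0 such that for every β > β₀ and every deterministic initial vector x⁰ ∈ [−A,A]ⁿ with 𝔛(0) > 0, under the constrained asymmetric belief process there exist random variables B₁, …, B_m, each taking values in {−A, A}, such that ℙ( lim_{k→∞} x_i(k) = B_j for all i ∈ V_j and all j = 1, …, m ) = 1. -/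

import Mathlib

open Matrix MeasureTheory Filter
open scoped ENNReal

noncomputable section

namespace SignedOpinion

/-- The vector `e i - e j` in `ℝⁿ`. -/
def esub {n : ℕ} (i j : Fin n) : Fin n → ℝ :=
  fun k => (if k = i then (1 : ℝ) else 0) - (if k = j then (1 : ℝ) else 0)

/-- The rank-one matrix `(e i - e j) (e i - e j)ᵀ`. -/
def dmatAux {n : ℕ} (i j : Fin n) : Matrix (Fin n) (Fin n) ℝ :=
  Matrix.vecMulVec (esub i j) (esub i j)

lemma dmatAux_symm {n : ℕ} (i j : Fin n) : dmatAux i j = dmatAux j i := by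
  ext a b
  simp only [dmatAux, esub, Matrix.vecMulVec_apply]
  ring

/-- `(e i - e j)(e i - e j)ᵀ` as a function of the unordered pair `{i, j}`. -/
def dmat {n : ℕ} : Sym2 (Fin n) → Matrix (Fin n) (Fin n) ℝ :=
  Sym2.lift ⟨dmatAux, dmatAux_symm⟩

/-- The averaging matrix `U = 𝟙𝟙ᵀ / n`. -/
def Umat (n : ℕ) : Matrix (Fin n) (Fin n) ℝ :=
  (n : ℝ)⁻¹ • Matrix.of (fun _ _ => (1 : ℝ))

/-- The positive update matrix `W⁺_{ij} = I - α (e i - e j)(e i - e j)ᵀ`. -/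
def Wpos {n : ℕ} (α : ℝ) (e : Sym2 (Fin n)) : Matrix (Fin n) (Fin n) ℝ :=
  1 - α • dmat e

/-- The negative update matrix `W⁻_{ij} = I + β (e i - e j)(e i - e j)ᵀ`. -/
def Wneg {n : ℕ} (β : ℝ) (e : Sym2 (Fin n)) : Matrix (Fin n) (Fin n) ℝ :=
  1 + β • dmat e

/-- The edge selection probability `μ({i,j}) = (p i j + p j i) / n`. -/
def edgeWeight {n : ℕ} (P : Matrix (Fin n) (Fin n) ℝ) : Sym2 (Fin n) → ℝ :=
  Sym2.lift ⟨fun i j => (P i j + P j i) / n, fun i j => by show (P i j + P j i) / n = (P j i + P i j) / n; rw [add_comm (P i j)]⟩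

/-- The weighted Laplacian of the graph on `Fin n` with edge set `Es`,
with weight `edgeWeight P e` on the edge `e`. -/
def lap {n : ℕ} (P : Matrix (Fin n) (Fin n) ℝ) (Es : Finset (Sym2 (Fin n))) :
    Matrix (Fin n) (Fin n) ℝ :=
  ∑ e ∈ Es, edgeWeight P e • dmat e

/-- The unit-weight (standard) Laplacian of the graph with edge set `Es`. -/
def lapStd {n : ℕ} (Es : Finset (Sym2 (Fin n))) : Matrix (Fin n) (Fin n) ℝ :=
  ∑ e ∈ Es, dmat e

/-- Largest (real) eigenvalue of a matrix. For a real symmetric matrix this is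
`λ_max`. -/
def lamMax {n : ℕ} (M : Matrix (Fin n) (Fin n) ℝ) : ℝ :=
  sSup {t : ℝ | ∃ v : Fin n → ℝ, v ≠ 0 ∧ M *ᵥ v = t • v}

/-- Smallest (real) eigenvalue of a matrix. -/
def lamMin {n : ℕ} (M : Matrix (Fin n) (Fin n) ℝ) : ℝ :=
  sInf {t : ℝ | ∃ v : Fin n → ℝ, v ≠ 0 ∧ M *ᵥ v = t • v}

/-- Second smallest eigenvalue of a (connected-graph) Laplacian: the smallest
eigenvalue attained by an eigenvector orthogonal to the all-ones vector. -/
def lam2 {n : ℕ} (M : Matrix (Fin n) (Fin n) ℝ) : ℝ :=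
  sInf {t : ℝ | ∃ v : Fin n → ℝ, v ≠ 0 ∧ (∑ i, v i = 0) ∧ M *ᵥ v = t • v}

/-- `P` is row-stochastic. -/
def RowStochastic {n : ℕ} (P : Matrix (Fin n) (Fin n) ℝ) : Prop :=
  (∀ i j, 0 ≤ P i j) ∧ ∀ i, ∑ j, P i j = 1

/-- `P` complies with the graph with edge set `E`. -/
def Complies {n : ℕ} (P : Matrix (Fin n) (Fin n) ℝ) (E : Finset (Sym2 (Fin n))) : Prop :=
  ∀ i j : Fin n, i ≠ j → 0 < P i j → s(i, j) ∈ E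

/-- The simple graph on `Fin n` with edge set `E`. -/
def graphOf {n : ℕ} (E : Finset (Sym2 (Fin n))) : SimpleGraph (Fin n) :=
  SimpleGraph.fromEdgeSet (↑E)

/-- `diam x = max_i x i - min_i x i`  (the quantity `𝔛` of the paper). -/
def diam {n : ℕ} (x : Fin n → ℝ) : ℝ := (⨆ i, x i) - ⨅ i, x i

/-- Selection alphabet `E ∪ {∗}` : an unordered node pair, or no selection. -/
abbrev Sel (n : ℕ) := Option (Sym2 (Fin n))

instance (n : ℕ) : MeasurableSpace (Sel n) := ⊤

/-- The update matrix triggered by a selection. -/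
def Wsel {n : ℕ} (α β : ℝ) (Epst Eneg : Finset (Sym2 (Fin n))) :
    Sel n → Matrix (Fin n) (Fin n) ℝ
  | none => 1
  | some e => if e ∈ Epst then Wpos α e else if e ∈ Eneg then Wneg β e else 1

/-- The belief process `x(k)` driven by the selection sequence `ω`. -/
def xproc {n : ℕ} (α β : ℝ) (Epst Eneg : Finset (Sym2 (Fin n))) (x0 : Fin n → ℝ)
    (ω : ℕ → Sel n) : ℕ → Fin n → ℝ
  | 0 => x0
  | k + 1 => Wsel α β Epst Eneg (ω k) *ᵥ xproc α β Epst Eneg x0 ω k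

/-- The matrix product `W(k) W(k-1) ⋯ W(0)`. -/
def Wprod {n : ℕ} (α β : ℝ) (Epst Eneg : Finset (Sym2 (Fin n))) (ω : ℕ → Sel n) :
    ℕ → Matrix (Fin n) (Fin n) ℝ
  | 0 => Wsel α β Epst Eneg (ω 0)
  | k + 1 => Wsel α β Epst Eneg (ω (k + 1)) * Wprod α β Epst Eneg ω k

/-- The one-step selection distribution `μ` on `E ∪ {∗}`. -/
def seldist {n : ℕ} (P : Matrix (Fin n) (Fin n) ℝ) (E : Finset (Sym2 (Fin n))) :
    Sel n → ℝ≥0∞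
  | none => ENNReal.ofReal (1 - ∑ e ∈ E, edgeWeight P e)
  | some e => if e ∈ E then ENNReal.ofReal (edgeWeight P e) else 0

/-- `ℙ` is the infinite product of `seldist P E`: the coordinates are i.i.d.
with per-coordinate distribution `seldist P E` (characterized on cylinders). -/
def IsIIDSel {n : ℕ} (ℙ : Measure (ℕ → Sel n)) (P : Matrix (Fin n) (Fin n) ℝ)
    (E : Finset (Sym2 (Fin n))) : Prop :=
  ∀ (K : Finset ℕ) (v : ℕ → Sel n),
    ℙ {ω | ∀ k ∈ K, ω k = v k} = ∏ k ∈ K, seldist P E (v k)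

/-- Selection alphabet for the asymmetric constrained model:
an ordered node pair (or `∗`), together with a tag in `{1,2,3}`. -/
abbrev Sel2 (n : ℕ) := Option (Fin n × Fin n) × Fin 3

instance (n : ℕ) : MeasurableSpace (Sel2 n) := ⊤

/-- weights `a, b, c` on the tags. -/
def wabc (a b c : ℝ) : Fin 3 → ℝ := ![a, b, c]

/-- Per-step distribution for the asymmetric constrained model: the pair
`({i,j}, t)` (represented by its ordered representative with `i < j`) has mass
`(wabc a b c t) · μ({i,j})`, and `(∗, t)` has mass `(wabc a b c t) · μ(∗)`. -/
def seldist2 {n : ℕ} (P : Matrix (Fin n) (Fin n) ℝ) (E : Finset (Sym2 (Fin n)))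
    (a b c : ℝ) : Sel2 n → ℝ≥0∞
  | (none, t) => ENNReal.ofReal (wabc a b c t) * ENNReal.ofReal (1 - ∑ e ∈ E, edgeWeight P e)
  | (some (i, j), t) =>
      if i < j ∧ s(i, j) ∈ E then
        ENNReal.ofReal (wabc a b c t) * ENNReal.ofReal (edgeWeight P s(i, j))
      else 0

/-- `ℙ` is the infinite product of `seldist2 P E a b c`. -/
def IsIIDSel2 {n : ℕ} (ℙ : Measure (ℕ → Sel2 n)) (P : Matrix (Fin n) (Fin n) ℝ)
    (E : Finset (Sym2 (Fin n))) (a b c : ℝ) : Prop :=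
  ∀ (K : Finset ℕ) (v : ℕ → Sel2 n),
    ℙ {ω | ∀ k ∈ K, ω k = v k} = ∏ k ∈ K, seldist2 P E a b c (v k)

/-- Projection onto `[-A, A]`. -/
def projA (A z : ℝ) : ℝ := max (-A) (min A z)

/-- `θ(e) = α` on positive edges, `-β` on negative edges. -/
def theta {n : ℕ} (α β : ℝ) (Epst Eneg : Finset (Sym2 (Fin n))) (e : Sym2 (Fin n)) : ℝ :=
  if e ∈ Epst then α else if e ∈ Eneg then -β else 0

/-- One step of the asymmetric constrained update. -/
def cstep {n : ℕ} (α β A : ℝ) (Epst Eneg : Finset (Sym2 (Fin n))) :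
    Sel2 n → (Fin n → ℝ) → (Fin n → ℝ)
  | (none, _), x => x
  | (some (i, j), t), x =>
      if t = 0 then
        Function.update x i
          (projA A ((1 - theta α β Epst Eneg s(i, j)) * x i + theta α β Epst Eneg s(i, j) * x j))
      else if t = 1 then
        Function.update x j
          (projA A ((1 - theta α β Epst Eneg s(i, j)) * x j + theta α β Epst Eneg s(i, j) * x i))
      else
        Function.update
          (Function.update x i
            (projA A ((1 - theta α β Epst Eneg s(i, j)) * x i + theta α β Epst Eneg s(i, j) * x j)))
          j
          (projA A ((1 - theta α β Epst Eneg s(i, j)) * x j + theta α β Epst Eneg s(i, j) * x i))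

/-- The constrained asymmetric belief process. -/
def cproc {n : ℕ} (α β A : ℝ) (Epst Eneg : Finset (Sym2 (Fin n))) (x0 : Fin n → ℝ)
    (ω : ℕ → Sel2 n) : ℕ → Fin n → ℝ
  | 0 => x0
  | k + 1 => cstep α β A Epst Eneg (ω k) (cproc α β A Epst Eneg x0 ω k)


/-! ### Finite-alphabet random iteration -/

/-- The one-step averaging operator of the random iteration of the maps `step s`,
where `s` is drawn with weight `q s`. -/
def avgOp {S X : Type*} [Fintype S] (q : S → ℝ) (step : S → X → X) (g : X → ℝ) : X → ℝ :=
  fun x => ∑ s, q s * g (step s x)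

/-- The state reached from `x` after applying the letters of `w` in order. -/
def wordState {S X : Type*} (step : S → X → X) (x : X) : (k : ℕ) → (Fin k → S) → X
  | 0, _ => x
  | k + 1, w => step (w (Fin.last k)) (wordState step x k fun i => w i.castSucc)

lemma sum_wordState {S X : Type*} [Fintype S] (q : S → ℝ) (step : S → X → X)
    (x : X) (k : ℕ) (g : X → ℝ) :
    ∑ w : Fin k → S, (∏ i, q (w i)) * g (wordState step x k w) = (avgOp q step)^[k] g x := by
  induction k generalizing g with
  | zero => simp [wordState]
  | succ k ih =>
    rw [Function.iterate_succ_apply, ← ih, ← (Fin.snocEquiv fun _ => S).sum_comp,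
      Fintype.sum_prod_type, Finset.sum_comm]
    refine Finset.sum_congr rfl fun w _ => ?_
    rw [avgOp, Finset.mul_sum]
    refine Finset.sum_congr rfl fun s _ => ?_
    simp [Fin.snocEquiv, wordState, Fin.prod_univ_castSucc, mul_assoc]

lemma avgOp_mono {S X : Type*} [Fintype S] {q : S → ℝ} (hq : ∀ s, 0 ≤ q s) {step : S → X → X}
    {I : Set X} (hI : ∀ s, ∀ x ∈ I, step s x ∈ I) (k : ℕ) {f g : X → ℝ}
    (hfg : ∀ x ∈ I, f x ≤ g x) :
    ∀ x ∈ I, (avgOp q step)^[k] f x ≤ (avgOp q step)^[k] g x := by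
  induction k generalizing f g with
  | zero => simpa using hfg
  | succ k ih =>
    simp only [Function.iterate_succ_apply]
    exact ih fun x hx => Finset.sum_le_sum fun s _ =>
      mul_le_mul_of_nonneg_left (hfg _ (hI s x hx)) (hq s)

lemma iterate_avgOp_const_mul {S X : Type*} [Fintype S] (q : S → ℝ) (step : S → X → X)
    (k : ℕ) (c : ℝ) (f : X → ℝ) (x : X) :
    (avgOp q step)^[k] (fun y => c * f y) x = c * (avgOp q step)^[k] f x := by
  simp only [← sum_wordState, Finset.mul_sum]
  exact Finset.sum_congr rfl fun w _ => by ring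

lemma iterate_avgOp_le_pow {S X : Type*} [Fintype S] {q : S → ℝ} (hq : ∀ s, 0 ≤ q s)
    (hq1 : ∑ s, q s = 1) {step : S → X → X} {I : Set X} (hI : ∀ s, ∀ x ∈ I, step s x ∈ I)
    {c : ℝ} (hc : 0 ≤ c) {w : X → ℝ} (hw : ∀ s, ∀ x ∈ I, w (step s x) ≤ c * w x) (k : ℕ) :
    ∀ x ∈ I, (avgOp q step)^[k] w x ≤ c ^ k * w x := by
  induction k with
  | zero => simp
  | succ k ih =>
    intro x hx
    rw [Function.iterate_succ_apply']
    calc ∑ s, q s * (avgOp q step)^[k] w (step s x)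
        ≤ ∑ s, q s * (c ^ k * (c * w x)) := by
          refine Finset.sum_le_sum fun s _ => mul_le_mul_of_nonneg_left ?_ (hq s)
          exact (ih _ (hI s x hx)).trans
            (mul_le_mul_of_nonneg_left (hw s x hx) (pow_nonneg hc k))
      _ = c ^ (k + 1) * w x := by rw [← Finset.sum_mul, hq1]; ring

lemma prod_map_le_one {S : Type*} {q : S → ℝ} (hq : ∀ s, 0 ≤ q s) (hq1 : ∀ s, q s ≤ 1)
    (l : List S) : (l.map q).prod ≤ 1 := by
  induction l with
  | nil => simp
  | cons s l ih =>
    rw [List.map_cons, List.prod_cons]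
    exact (mul_le_of_le_one_right (hq s) ih).trans (hq1 s)

/-- A word of total weight `p` leading to a state where `w` is small improves the
trivial bound on the iterated average of `w`. -/
lemma iterate_avgOp_le_of_word {S X : Type*} [Fintype S] {q : S → ℝ} (hq : ∀ s, 0 ≤ q s)
    (hq1 : ∑ s, q s = 1) {step : S → X → X} {I : Set X} (hI : ∀ s, ∀ x ∈ I, step s x ∈ I)
    {c : ℝ} (hc : 0 ≤ c) {w : X → ℝ} (hw : ∀ s, ∀ x ∈ I, w (step s x) ≤ c * w x)
    (l : List S) :
    ∀ x ∈ I, (avgOp q step)^[l.length] w x ≤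
      (1 - (l.map q).prod) * c ^ l.length * w x +
        (l.map q).prod * w (l.foldl (fun y s => step s y) x) := by
  classical
  induction l with
  | nil => simp
  | cons s₀ l ih =>
    intro x hx
    have hle1 : (l.map q).prod ≤ 1 := prod_map_le_one hq
      (fun s => hq1 ▸ Finset.single_le_sum (fun s _ => hq s) (Finset.mem_univ s)) l
    have hrest : ∑ s ∈ Finset.univ.erase s₀, q s = 1 - q s₀ := by
      rw [← hq1, ← Finset.add_sum_erase _ _ (Finset.mem_univ s₀)]; ring
    rw [List.length_cons, Function.iterate_succ_apply', avgOp,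
      ← Finset.add_sum_erase _ _ (Finset.mem_univ s₀)]
    have h1 := ih _ (hI s₀ x hx)
    have h2 : ∑ s ∈ Finset.univ.erase s₀, q s * (avgOp q step)^[l.length] w (step s x) ≤
        (1 - q s₀) * (c ^ l.length * (c * w x)) := by
      rw [← hrest, Finset.sum_mul]
      refine Finset.sum_le_sum fun s _ => mul_le_mul_of_nonneg_left ?_ (hq s)
      exact (iterate_avgOp_le_pow hq hq1 hI hc hw _ _ (hI s x hx)).trans
        (mul_le_mul_of_nonneg_left (hw s x hx) (pow_nonneg hc _))
    have h3 : (1 - (l.map q).prod) * c ^ l.length * w (step s₀ x) ≤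
        (1 - (l.map q).prod) * c ^ l.length * (c * w x) :=
      mul_le_mul_of_nonneg_left (hw s₀ x hx)
        (mul_nonneg (by linarith) (pow_nonneg hc _))
    have h4 := mul_le_mul_of_nonneg_left (h1.trans (add_le_add_left h3 _)) (hq s₀)
    refine (add_le_add h4 h2).trans (le_of_eq ?_)
    simp only [List.map_cons, List.prod_cons, List.foldl_cons]
    ring

lemma measureReal_prefix {S : Type*} [MeasurableSpace S] {μ : Measure (ℕ → S)}
    [IsProbabilityMeasure μ] {q : S → ℝ≥0∞}
    (hμ : ∀ (K : Finset ℕ) (v : ℕ → S), μ {ω | ∀ k ∈ K, ω k = v k} = ∏ k ∈ K, q (v k))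
    (k : ℕ) (w : Fin k → S) :
    μ.real ((fun (ω : ℕ → S) (i : Fin k) => ω i) ⁻¹' {w}) = ∏ i, (q (w i)).toReal := by
  have : Nonempty (ℕ → S) := μ.nonempty_of_neZero
  obtain ⟨ω₀⟩ := this
  have h := hμ (Finset.range k) fun j => if h : j < k then w ⟨j, h⟩ else ω₀ 0
  rw [Finset.prod_range] at h
  simp only [Fin.is_lt, dite_true, Fin.eta] at h
  rw [← ENNReal.toReal_prod, ← h, measureReal_def]
  congr 2
  ext ω
  simp only [Set.mem_preimage, Set.mem_singleton_iff, funext_iff, Set.mem_ofPred_eq,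
    Finset.mem_range]
  constructor
  · intro hω j hj
    simpa [hj] using hω ⟨j, hj⟩
  · intro hω i
    simpa using hω i i.2

section RandomIteration

variable {S X : Type*} [Fintype S] [MeasurableSpace S] [DiscreteMeasurableSpace S]

lemma measurableSet_preimage_prefix (k : ℕ) (E : Set (Fin k → S)) :
    MeasurableSet ((fun (ω : ℕ → S) (i : Fin k) => ω i) ⁻¹' E) :=
  (measurable_pi_lambda _ fun _ => measurable_pi_apply _) E.toFinite.measurableSet

lemma sum_toReal_eq_one {μ : Measure (ℕ → S)} [IsProbabilityMeasure μ] {q : S → ℝ≥0∞}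
    (hμ : ∀ (K : Finset ℕ) (v : ℕ → S), μ {ω | ∀ k ∈ K, ω k = v k} = ∏ k ∈ K, q (v k)) :
    ∑ s, (q s).toReal = 1 := by
  have h := sum_measureReal_preimage_singleton (μ := μ) (Finset.univ : Finset (Fin 1 → S))
    (f := fun (ω : ℕ → S) (i : Fin 1) => ω i) (fun w _ => measurableSet_preimage_prefix 1 {w})
  simp only [measureReal_prefix hμ, Finset.coe_univ, Set.preimage_univ, probReal_univ] at h
  rw [← h, ← (Equiv.funUnique (Fin 1) S).symm.sum_comp]
  simp

lemma measureReal_state_mem {μ : Measure (ℕ → S)} [IsProbabilityMeasure μ] {q : S → ℝ≥0∞}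
    (hμ : ∀ (K : Finset ℕ) (v : ℕ → S), μ {ω | ∀ k ∈ K, ω k = v k} = ∏ k ∈ K, q (v k))
    (step : S → X → X) (x : X) (k : ℕ) (E : Set X) :
    μ.real {ω | wordState step x k (fun i => ω i) ∈ E} =
      (avgOp (fun s => (q s).toReal) step)^[k] (E.indicator 1) x := by
  classical
  rw [← sum_wordState]
  have h := sum_measureReal_preimage_singleton (μ := μ)
    (Finset.univ.filter fun w : Fin k → S => wordState step x k w ∈ E)
    (f := fun (ω : ℕ → S) (i : Fin k) => ω i) (fun w _ => measurableSet_preimage_prefix k {w})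
  simp only [measureReal_prefix hμ] at h
  rw [Finset.sum_filter] at h
  convert h.symm using 2
  · ext ω
    simp
  · simp [Set.indicator_apply]

/-- A multiplicative drift condition for a nonnegative function `w`, bounded below outside `D`,
forces the random iteration to visit `D` almost surely. -/
theorem ae_exists_mem_of_drift {μ : Measure (ℕ → S)} [IsProbabilityMeasure μ] {q : S → ℝ≥0∞}
    (hμ : ∀ (K : Finset ℕ) (v : ℕ → S), μ {ω | ∀ k ∈ K, ω k = v k} = ∏ k ∈ K, q (v k))
    {step : S → X → X} {I D : Set X} (hI : ∀ s, ∀ x ∈ I, step s x ∈ I)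
    {w : X → ℝ} {M ρ : ℝ} {N : ℕ} (hM : 0 ≤ M) (hρ0 : 0 ≤ ρ) (hρ1 : ρ < 1)
    (hw0 : ∀ x ∈ I, 0 ≤ w x) (hwM : ∀ x ∈ I, x ∉ D → 1 ≤ M * w x)
    (hdrift : ∀ x ∈ I, (avgOp (fun s => (q s).toReal) step)^[N] w x ≤ ρ * w x)
    {x : X} (hx : x ∈ I) :
    ∀ᵐ ω ∂μ, ∃ k, wordState step x k (fun i => ω i) ∈ D := by
  have hq : ∀ s, 0 ≤ (q s).toReal := fun s => ENNReal.toReal_nonneg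
  have hpow : ∀ j : ℕ, (avgOp (fun s => (q s).toReal) step)^[N * j] w x ≤ ρ ^ j * w x := by
    intro j
    induction j with
    | zero => simp
    | succ j ih =>
      rw [Nat.mul_succ, Function.iterate_add_apply]
      refine (avgOp_mono hq hI (N * j) hdrift x hx).trans ?_
      rw [iterate_avgOp_const_mul, pow_succ', mul_assoc]
      exact mul_le_mul_of_nonneg_left ih hρ0
  have hbound : ∀ j : ℕ, μ.real {ω | ∀ k, wordState step x k (fun i => ω i) ∉ D} ≤
      M * w x * ρ ^ j := by
    intro j
    calc μ.real {ω | ∀ k, wordState step x k (fun i => ω i) ∉ D}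
        ≤ μ.real {ω | wordState step x (N * j) (fun i => ω i) ∈ Dᶜ} :=
          measureReal_mono fun ω hω => hω (N * j)
      _ = (avgOp (fun s => (q s).toReal) step)^[N * j] (Dᶜ.indicator 1) x :=
          measureReal_state_mem hμ step x _ _
      _ ≤ (avgOp (fun s => (q s).toReal) step)^[N * j] (fun y => M * w y) x := by
          refine avgOp_mono hq hI _ (fun y hy => ?_) x hx
          by_cases hyD : y ∈ D
          · simpa [hyD] using mul_nonneg hM (hw0 y hy)
          · simpa [hyD] using hwM y hy hyD
      _ ≤ M * w x * ρ ^ j := by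
          rw [iterate_avgOp_const_mul, mul_assoc, mul_comm (w x)]
          exact mul_le_mul_of_nonneg_left (hpow j) hM
  have hlim : Tendsto (fun j : ℕ => M * w x * ρ ^ j) atTop (nhds 0) := by
    simpa using (tendsto_pow_atTop_nhds_zero_of_lt_one hρ0 hρ1).const_mul (M * w x)
  have hzero : μ.real {ω | ∀ k, wordState step x k (fun i => ω i) ∉ D} = 0 :=
    le_antisymm (ge_of_tendsto' hlim hbound) measureReal_nonneg
  rw [measureReal_eq_zero_iff] at hzero
  rw [ae_iff]
  simpa only [not_exists] using hzero

end RandomIteration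

/-! ### One step of the constrained process -/

/-- The updated belief of node `i` after interacting with node `j` with strength `θ`. -/
def pull {n : ℕ} (A θ : ℝ) (x : Fin n → ℝ) (i j : Fin n) : ℝ :=
  projA A ((1 - θ) * x i + θ * x j)

/-- The cube `[-A, A]ⁿ`. -/
def box (n : ℕ) (A : ℝ) : Set (Fin n → ℝ) := {x | ∀ i, x i ∈ Set.Icc (-A) A}

lemma projA_mem {A : ℝ} (hA : 0 ≤ A) (z : ℝ) : projA A z ∈ Set.Icc (-A) A :=
  ⟨le_max_left _ _, max_le (by linarith) (min_le_left _ _)⟩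

lemma projA_of_mem {A z : ℝ} (hz : z ∈ Set.Icc (-A) A) : projA A z = z := by
  rw [projA, min_eq_right hz.2, max_eq_right hz.1]

lemma projA_of_le {A z : ℝ} (hA : 0 ≤ A) (hz : A ≤ z) : projA A z = A := by
  rw [projA, min_eq_left hz, max_eq_right (by linarith)]

lemma projA_of_le_neg {A z : ℝ} (hA : 0 ≤ A) (hz : z ≤ -A) : projA A z = -A := by
  rw [projA, min_eq_right (by linarith), max_eq_left hz]

lemma projA_mono {A z z' : ℝ} (h : z ≤ z') : projA A z ≤ projA A z' :=
  max_le_max le_rfl (min_le_min le_rfl h)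

lemma pull_of_convex {n : ℕ} {A α : ℝ} (hα0 : 0 ≤ α) (hα1 : α ≤ 1) {x : Fin n → ℝ}
    (hx : x ∈ box n A) (i j : Fin n) : pull A α x i j = (1 - α) * x i + α * x j := by
  have hi := hx i
  have hj := hx j
  simp only [Set.mem_Icc] at hi hj
  exact projA_of_mem ⟨by nlinarith, by nlinarith⟩

lemma pull_of_eq {n : ℕ} {A θ : ℝ} {x : Fin n → ℝ} (hx : x ∈ box n A) {i j : Fin n}
    (hij : x i = x j) : pull A θ x i j = x i := by
  have : (1 - θ) * x i + θ * x j = x i := by rw [← hij]; ring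
  rw [pull, this, projA_of_mem (hx i)]

lemma le_pull_neg {n : ℕ} {A β : ℝ} (hβ : 0 ≤ β) {x : Fin n → ℝ} (hx : x ∈ box n A)
    {i j : Fin n} (hij : x j ≤ x i) : x i ≤ pull A (-β) x i j := by
  conv_lhs => rw [← projA_of_mem (hx i)]
  exact projA_mono (by nlinarith)

lemma pull_neg_le {n : ℕ} {A β : ℝ} (hβ : 0 ≤ β) {x : Fin n → ℝ} (hx : x ∈ box n A)
    {i j : Fin n} (hij : x i ≤ x j) : pull A (-β) x i j ≤ x i := by
  conv_rhs => rw [← projA_of_mem (hx i)]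
  exact projA_mono (by nlinarith)

lemma update_mem_box {n : ℕ} {A z : ℝ} {x : Fin n → ℝ} (hx : x ∈ box n A) (i : Fin n)
    (hz : z ∈ Set.Icc (-A) A) : Function.update x i z ∈ box n A := by
  intro k
  by_cases hk : k = i
  · subst hk; simpa using hz
  · simpa [hk] using hx k

lemma cstep_pair_cases {n : ℕ} (α β A : ℝ) (Epst Eneg : Finset (Sym2 (Fin n))) (i j : Fin n)
    (t : Fin 3) (x : Fin n → ℝ) :
    cstep α β A Epst Eneg (some (i, j), t) x =
        Function.update x i (pull A (theta α β Epst Eneg s(i, j)) x i j) ∨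
      cstep α β A Epst Eneg (some (i, j), t) x =
        Function.update x j (pull A (theta α β Epst Eneg s(i, j)) x j i) ∨
      cstep α β A Epst Eneg (some (i, j), t) x =
        Function.update (Function.update x i (pull A (theta α β Epst Eneg s(i, j)) x i j)) j
          (pull A (theta α β Epst Eneg s(i, j)) x j i) := by
  simp only [cstep, pull]
  split_ifs <;> simp

lemma cstep_mem_box {n : ℕ} {α β A : ℝ} (hA : 0 ≤ A) (Epst Eneg : Finset (Sym2 (Fin n)))
    (s : Sel2 n) {x : Fin n → ℝ} (hx : x ∈ box n A) : cstep α β A Epst Eneg s x ∈ box n A := by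
  obtain ⟨_ | ⟨i, j⟩, t⟩ := s
  · exact hx
  · rcases cstep_pair_cases α β A Epst Eneg i j t x with h | h | h <;> rw [h]
    · exact update_mem_box hx _ (projA_mem hA _)
    · exact update_mem_box hx _ (projA_mem hA _)
    · exact update_mem_box (update_mem_box hx _ (projA_mem hA _)) _ (projA_mem hA _)

lemma cstep_eq_self {n : ℕ} {α β A : ℝ} {Epst Eneg : Finset (Sym2 (Fin n))} {x : Fin n → ℝ}
    (h : ∀ i j, pull A (theta α β Epst Eneg s(i, j)) x i j = x i) (s : Sel2 n) :
    cstep α β A Epst Eneg s x = x := by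
  obtain ⟨_ | ⟨i, j⟩, t⟩ := s
  · rfl
  · have hji := h j i
    rw [Sym2.eq_swap] at hji
    rcases cstep_pair_cases α β A Epst Eneg i j t x with e | e | e <;> rw [e] <;> simp [h, hji]

/-- A letter of the alphabet that encodes an unordered pair of distinct nodes. -/
def IsPairLetter {n : ℕ} (s : Sel2 n) : Prop :=
  ∃ i j : Fin n, ∃ t : Fin 3, i < j ∧ s = (some (i, j), t)

lemma exists_letter_update {n : ℕ} (α β A : ℝ) (Epst Eneg : Finset (Sym2 (Fin n)))
    {u v : Fin n} (huv : u ≠ v) (x : Fin n → ℝ) :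
    ∃ s : Sel2 n, IsPairLetter s ∧ cstep α β A Epst Eneg s x =
      Function.update x u (pull A (theta α β Epst Eneg s(u, v)) x u v) := by
  rcases lt_or_gt_of_ne huv with h | h
  · exact ⟨(some (u, v), 0), ⟨u, v, 0, h, rfl⟩, by simp [cstep, pull]⟩
  · exact ⟨(some (v, u), 1), ⟨v, u, 1, h, rfl⟩, by simp [cstep, pull, Sym2.eq_swap]⟩

lemma exists_letter_update_update {n : ℕ} (α β A : ℝ) (Epst Eneg : Finset (Sym2 (Fin n)))
    {u v : Fin n} (huv : u ≠ v) (x : Fin n → ℝ) :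
    ∃ s : Sel2 n, IsPairLetter s ∧
      cstep α β A Epst Eneg s x u = pull A (theta α β Epst Eneg s(u, v)) x u v ∧
      cstep α β A Epst Eneg s x v = pull A (theta α β Epst Eneg s(u, v)) x v u := by
  rcases lt_or_gt_of_ne huv with h | h
  · exact ⟨(some (u, v), 2), ⟨u, v, 2, h, rfl⟩, by simp [cstep, pull, huv]⟩
  · refine ⟨(some (v, u), 2), ⟨v, u, 2, h, rfl⟩, ?_⟩
    rw [Sym2.eq_swap]
    simp [cstep, pull, huv.symm]

/-! ### The diameter along the process -/

lemma sub_le_diam {n : ℕ} (x : Fin n → ℝ) (i j : Fin n) : x i - x j ≤ diam x :=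
  sub_le_sub (le_ciSup (Set.finite_range x).bddAbove i) (ciInf_le (Set.finite_range x).bddBelow j)

lemma exists_diam_eq {n : ℕ} [NeZero n] (x : Fin n → ℝ) :
    ∃ p q, diam x = x p - x q ∧ ∀ k, x q ≤ x k ∧ x k ≤ x p := by
  obtain ⟨p, hp⟩ := exists_eq_ciSup_of_finite (f := x)
  obtain ⟨q, hq⟩ := exists_eq_ciInf_of_finite (f := x)
  refine ⟨p, q, by rw [diam, hp, hq], fun k => ⟨?_, ?_⟩⟩
  · rw [hq]; exact ciInf_le (Set.finite_range x).bddBelow k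
  · rw [hp]; exact le_ciSup (Set.finite_range x).bddAbove k

lemma diam_le_of_mem_box {n : ℕ} [NeZero n] {A : ℝ} {x : Fin n → ℝ} (hx : x ∈ box n A) :
    diam x ≤ 2 * A := by
  obtain ⟨p, q, h, -⟩ := exists_diam_eq x
  have hp := (hx p).2
  have hq := (hx q).1
  linarith

lemma diam_update_convex {n : ℕ} [NeZero n] {α : ℝ} (hα0 : 0 ≤ α)
    (x : Fin n → ℝ) (i j : Fin n) :
    (1 - α) * diam x ≤ diam (Function.update x i ((1 - α) * x i + α * x j)) := by
  obtain ⟨p, q, hd, hpq⟩ := exists_diam_eq x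
  have h := sub_le_diam (Function.update x i ((1 - α) * x i + α * x j)) p q
  have hj := hpq j
  have hi := hpq i
  refine le_trans ?_ h
  rw [hd]
  by_cases hp : p = i <;> by_cases hq : q = i <;>
    simp only [Function.update_apply, hp, hq, if_true, if_false] <;>
    (try subst hp) <;> (try subst hq) <;> nlinarith

lemma diam_update_update_convex {n : ℕ} [NeZero n] {α : ℝ} (hα0 : 0 ≤ α) (hα1 : α ≤ 1)
    (x : Fin n → ℝ) {i j : Fin n} (hij : i ≠ j) :
    |1 - 2 * α| / 2 * diam x ≤ diam (Function.update (Function.update x i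
      ((1 - α) * x i + α * x j)) j ((1 - α) * x j + α * x i)) := by
  set y := Function.update (Function.update x i
      ((1 - α) * x i + α * x j)) j ((1 - α) * x j + α * x i) with hy
  have hyi : y i = (1 - α) * x i + α * x j := by simp [hy, hij]
  have hyj : y j = (1 - α) * x j + α * x i := by simp [hy]
  have hyk : ∀ k, k ≠ i → k ≠ j → y k = x k := fun k h1 h2 => by simp [hy, h1, h2]
  obtain ⟨p, q, hd, hpq⟩ := exists_diam_eq x
  have hd0 : 0 ≤ diam x := hd ▸ sub_nonneg.2 (hpq q).2
  have habs1 : |1 - 2 * α| ≤ 1 := abs_le.2 ⟨by linarith, by linarith⟩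
  by_cases hgap : diam x / 2 ≤ |x i - x j|
  · have h : |1 - 2 * α| * |x i - x j| ≤ diam y := by
      rw [← abs_mul, abs_le]
      have h1 := sub_le_diam y i j
      have h2 := sub_le_diam y j i
      rw [hyi, hyj] at h1 h2
      constructor <;> nlinarith
    nlinarith [abs_nonneg (1 - 2 * α)]
  · push Not at hgap
    have hhalf : diam x / 2 ≤ diam y := by
      obtain ⟨h1, h2⟩ := abs_lt.1 hgap
      have h := sub_le_diam y p q
      have hyp : ∀ k, k = i ∨ k = j → |y k - x k| ≤ diam x / 2 := by
        rintro k (rfl | rfl)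
        · rw [hyi, abs_le]; constructor <;> nlinarith
        · rw [hyj, abs_le]; constructor <;> nlinarith
      by_cases hp : p = i ∨ p = j
      · have hp' := abs_le.1 (hyp p hp)
        by_cases hq : q = i ∨ q = j
        · rcases hp with rfl | rfl <;> rcases hq with rfl | rfl <;> linarith
        · push Not at hq
          rw [hyk q hq.1 hq.2] at h
          linarith
      · push Not at hp
        rw [hyk p hp.1 hp.2] at h
        by_cases hq : q = i ∨ q = j
        · have hq' := abs_le.1 (hyp q hq)
          linarith
        · push Not at hq
          rw [hyk q hq.1 hq.2] at h
          linarith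
    nlinarith

/-- If every node moves only away from the others, the diameter does not decrease. -/
lemma diam_le_of_spread {n : ℕ} [NeZero n] {x y : Fin n → ℝ}
    (hup : ∀ p, (∀ k, x k ≤ x p) → x p ≤ y p) (hdown : ∀ q, (∀ k, x q ≤ x k) → y q ≤ x q) :
    diam x ≤ diam y := by
  obtain ⟨p, q, hd, hpq⟩ := exists_diam_eq x
  have h := sub_le_diam y p q
  have h1 := hup p fun k => (hpq k).2
  have h2 := hdown q fun k => (hpq k).1
  linarith

lemma diam_cstep {n : ℕ} [NeZero n] {α β A : ℝ} (hα0 : 0 ≤ α) (hα1 : α ≤ 1) (hβ : 0 ≤ β)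
    {Epst Eneg : Finset (Sym2 (Fin n))}
    (hθ : ∀ i j, i ≠ j → theta α β Epst Eneg s(i, j) = α ∨ theta α β Epst Eneg s(i, j) = -β)
    (s : Sel2 n) {x : Fin n → ℝ} (hx : x ∈ box n A) :
    min (1 - α) (|1 - 2 * α| / 2) * diam x ≤ diam (cstep α β A Epst Eneg s x) := by
  have hd0 : 0 ≤ diam x := by simpa using sub_le_diam x 0 0
  have hself : min (1 - α) (|1 - 2 * α| / 2) * diam x ≤ diam x :=
    mul_le_of_le_one_left hd0 ((min_le_left _ _).trans (by linarith))
  obtain ⟨_ | ⟨i, j⟩, t⟩ := s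
  · exact hself
  by_cases hij : i = j
  · subst hij
    rcases cstep_pair_cases α β A Epst Eneg i i t x with h | h | h <;> rw [h] <;>
      simpa [pull_of_eq hx] using hself
  rcases hθ i j hij with e | e
  · rcases cstep_pair_cases α β A Epst Eneg i j t x with h | h | h <;>
      simp only [e, pull_of_convex hα0 hα1 hx] at h <;> rw [h]
    · exact (mul_le_mul_of_nonneg_right (min_le_left _ _) hd0).trans
        (diam_update_convex hα0 x i j)
    · exact (mul_le_mul_of_nonneg_right (min_le_left _ _) hd0).trans
        (diam_update_convex hα0 x j i)
    · exact (mul_le_mul_of_nonneg_right (min_le_right _ _) hd0).trans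
        (diam_update_update_convex hα0 hα1 x hij)
  · refine hself.trans ?_
    rcases cstep_pair_cases α β A Epst Eneg i j t x with h | h | h <;>
      rw [h, e] <;> refine diam_le_of_spread (fun p hp => ?_) (fun p hp => ?_) <;>
      by_cases hpi : p = i <;> by_cases hpj : p = j <;>
      (try subst hpi) <;> (try subst hpj) <;>
      simp_all [le_pull_neg, pull_neg_le]

lemma pow_mul_diam_le_foldl {n : ℕ} {A γ : ℝ} (hγ : 0 ≤ γ)
    {step : Sel2 n → (Fin n → ℝ) → Fin n → ℝ}
    (hbox : ∀ s, ∀ x ∈ box n A, step s x ∈ box n A)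
    (hstep : ∀ s, ∀ x ∈ box n A, γ * diam x ≤ diam (step s x)) (l : List (Sel2 n)) :
    ∀ x ∈ box n A, γ ^ l.length * diam x ≤ diam (l.foldl (fun y s => step s y) x) := by
  induction l with
  | nil => simp
  | cons s l ih =>
    intro x hx
    refine le_trans ?_ (ih _ (hbox s x hx))
    rw [List.length_cons, pow_succ, mul_assoc]
    exact mul_le_mul_of_nonneg_left (hstep s x hx) (pow_nonneg hγ _)

/-! ### Clustered boundary states -/

/-- States whose beliefs lie in `{-A, A}` and agree inside each cluster. -/
def clustered {n m : ℕ} (cl : Fin n → Fin m) (A : ℝ) : Set (Fin n → ℝ) :=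
  {x | (∀ i, x i = A ∨ x i = -A) ∧ ∀ i j, cl i = cl j → x i = x j}

/-- The interaction strength is `α` inside clusters and `-β` across clusters. -/
def ClusterSigned {n m : ℕ} (cl : Fin n → Fin m) (α β : ℝ) (Epst Eneg : Finset (Sym2 (Fin n))) :
    Prop :=
  ∀ i j, i ≠ j → theta α β Epst Eneg s(i, j) = if cl i = cl j then α else -β

lemma mem_box_of_mem_clustered {n m : ℕ} {cl : Fin n → Fin m} {A : ℝ} (hA : 0 ≤ A)
    {x : Fin n → ℝ} (hx : x ∈ clustered cl A) : x ∈ box n A := by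
  intro i
  rcases hx.1 i with h | h <;> rw [h] <;> constructor <;> linarith

lemma cstep_of_mem_clustered {n m : ℕ} {cl : Fin n → Fin m} {α β A : ℝ} (hA : 0 ≤ A)
    (hβ : 0 ≤ β) {Epst Eneg : Finset (Sym2 (Fin n))} (hsign : ClusterSigned cl α β Epst Eneg)
    {x : Fin n → ℝ} (hx : x ∈ clustered cl A) (s : Sel2 n) :
    cstep α β A Epst Eneg s x = x := by
  refine cstep_eq_self (fun i j => ?_) s
  have hbox := mem_box_of_mem_clustered hA hx
  by_cases hij : x i = x j
  · exact pull_of_eq hbox hij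
  have hcl : cl i ≠ cl j := fun h => hij (hx.2 i j h)
  have hne : i ≠ j := fun h => hij (by rw [h])
  rw [hsign i j hne, if_neg hcl]
  rcases hx.1 i with hi | hi
  · refine le_antisymm (hi ▸ (projA_mem hA _).2) (le_pull_neg hβ hbox ?_)
    rw [hi]; exact (hbox j).2
  · refine le_antisymm (pull_neg_le hβ hbox ?_) (hi ▸ (projA_mem hA _).1)
    rw [hi]; exact (hbox j).1

lemma foldl_of_mem_clustered {n m : ℕ} {cl : Fin n → Fin m} {α β A : ℝ} (hA : 0 ≤ A)
    (hβ : 0 ≤ β) {Epst Eneg : Finset (Sym2 (Fin n))} (hsign : ClusterSigned cl α β Epst Eneg)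
    {x : Fin n → ℝ} (hx : x ∈ clustered cl A) (l : List (Sel2 n)) :
    l.foldl (fun y s => cstep α β A Epst Eneg s y) x = x := by
  induction l with
  | nil => rfl
  | cons s l ih => rw [List.foldl_cons, cstep_of_mem_clustered hA hβ hsign hx, ih]

/-- Starting with opposite extreme beliefs in two clusters, any further node can be moved to a
boundary value compatible with its cluster in at most two steps. -/
lemma exists_word_move_node {n m : ℕ} {cl : Fin n → Fin m} {α β A : ℝ} (hA : 0 < A)
    (hα0 : 0 < α) (hα1 : α < 1) (hβ : 1 ≤ α * β) {Epst Eneg : Finset (Sym2 (Fin n))}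
    (hsign : ClusterSigned cl α β Epst Eneg) {u v : Fin n} {F : Finset (Fin n)}
    (hu : u ∈ F) (hv : v ∈ F) {y : Fin n → ℝ} (hy : y ∈ box n A) (hyu : y u = A) (hyv : y v = -A)
    (hF : ∀ k ∈ F, y k = A ∨ y k = -A) (hcl : ∀ k ∈ F, ∀ k' ∈ F, cl k = cl k' → y k = y k')
    {k : Fin n} (hk : k ∉ F) :
    ∃ l : List (Sel2 n), l.length ≤ 2 ∧ (∀ s ∈ l, IsPairLetter s) ∧ ∃ z : ℝ,
      (z = A ∨ z = -A) ∧ (∀ k' ∈ F, cl k = cl k' → z = y k') ∧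
      l.foldl (fun y s => cstep α β A Epst Eneg s y) y = Function.update y k z := by
  have hβ1 : 1 ≤ β := by nlinarith
  have hku : k ≠ u := fun h => hk (h ▸ hu)
  have hkv : k ≠ v := fun h => hk (h ▸ hv)
  have hyk := hy k
  by_cases hex : ∃ k' ∈ F, cl k = cl k'
  · obtain ⟨k', hk', hkk'⟩ := hex
    have hne : k ≠ k' := fun h => hk (h ▸ hk')
    obtain ⟨s, hs, hs'⟩ := exists_letter_update α β A Epst Eneg hne y
    rw [hsign k k' hne, if_pos hkk', pull_of_convex hα0.le hα1.le hy] at hs'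
    set y' := Function.update y k ((1 - α) * y k + α * y k') with hy'
    have hz : ∀ k'' ∈ F, cl k = cl k'' → y k' = y k'' := fun k'' h h' =>
      hcl k' hk' k'' h (hkk'.symm.trans h')
    have hy'k : y' k = (1 - α) * y k + α * y k' := by simp [hy']
    rcases hF k' hk' with e | e
    · have hclv : cl k ≠ cl v := fun h => by
        have h1 := hz v hv h
        rw [e, hyv] at h1
        linarith
      obtain ⟨t, ht, ht'⟩ := exists_letter_update α β A Epst Eneg hkv y'
      refine ⟨[s, t], le_rfl, by simp [hs, ht], y k', hF k' hk', hz, ?_⟩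
      have hp : pull A (-β) y' k v = y k' := by
        rw [e]
        refine projA_of_le hA.le ?_
        have : y' v = -A := by simp [hy', hkv.symm, hyv]
        rw [hy'k, this, e]
        nlinarith [hyk.1, hyk.2]
      simp only [List.foldl_cons, List.foldl_nil]
      rw [hs', ht', hsign k v hkv, if_neg hclv, hp, hy', Function.update_idem]
    · have hclu : cl k ≠ cl u := fun h => by
        have h1 := hz u hu h
        rw [e, hyu] at h1
        linarith
      obtain ⟨t, ht, ht'⟩ := exists_letter_update α β A Epst Eneg hku y'
      refine ⟨[s, t], le_rfl, by simp [hs, ht], y k', hF k' hk', hz, ?_⟩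
      have hp : pull A (-β) y' k u = y k' := by
        rw [e]
        refine projA_of_le_neg hA.le ?_
        have : y' u = A := by simp [hy', hku.symm, hyu]
        rw [hy'k, this, e]
        nlinarith [hyk.1, hyk.2]
      simp only [List.foldl_cons, List.foldl_nil]
      rw [hs', ht', hsign k u hku, if_neg hclu, hp, hy', Function.update_idem]
  · push Not at hex
    rcases le_total 0 (y k) with h0 | h0
    · obtain ⟨s, hs, hs'⟩ := exists_letter_update α β A Epst Eneg hkv y
      refine ⟨[s], by simp, by simp [hs], A, Or.inl rfl, fun k' h h' => absurd h' (hex k' h), ?_⟩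
      have hp : pull A (-β) y k v = A := projA_of_le hA.le (by rw [hyv]; nlinarith)
      simp only [List.foldl_cons, List.foldl_nil]
      rw [hs', hsign k v hkv, if_neg (hex v hv), hp]
    · obtain ⟨s, hs, hs'⟩ := exists_letter_update α β A Epst Eneg hku y
      refine ⟨[s], by simp, by simp [hs], -A, Or.inr rfl, fun k' h h' => absurd h' (hex k' h), ?_⟩
      have hp : pull A (-β) y k u = -A := projA_of_le_neg hA.le (by rw [hyu]; nlinarith)
      simp only [List.foldl_cons, List.foldl_nil]
      rw [hs', hsign k u hku, if_neg (hex u hu), hp]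

/-- Opposite extreme beliefs in two different clusters propagate to a clustered boundary state. -/
lemma exists_word_clustered {n m : ℕ} {cl : Fin n → Fin m} {α β A : ℝ} (hA : 0 < A)
    (hα0 : 0 < α) (hα1 : α < 1) (hβ : 1 ≤ α * β) {Epst Eneg : Finset (Sym2 (Fin n))}
    (hsign : ClusterSigned cl α β Epst Eneg) {u v : Fin n} (huv : cl u ≠ cl v)
    {x : Fin n → ℝ} (hx : x ∈ box n A) (hxu : x u = A) (hxv : x v = -A) :
    ∃ l : List (Sel2 n), l.length ≤ 2 * n ∧ (∀ s ∈ l, IsPairLetter s) ∧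
      l.foldl (fun y s => cstep α β A Epst Eneg s y) x ∈ clustered cl A := by
  suffices H : ∀ G : Finset (Fin n), ∃ l : List (Sel2 n), l.length ≤ 2 * G.card ∧
      (∀ s ∈ l, IsPairLetter s) ∧ ∃ F : Finset (Fin n), u ∈ F ∧ v ∈ F ∧ G ⊆ F ∧
      ∃ y ∈ box n A, l.foldl (fun y s => cstep α β A Epst Eneg s y) x = y ∧ y u = A ∧ y v = -A ∧
      (∀ k ∈ F, y k = A ∨ y k = -A) ∧ ∀ k ∈ F, ∀ k' ∈ F, cl k = cl k' → y k = y k' by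
    obtain ⟨l, hl, hs, F, -, -, hGF, y, -, rfl, -, -, h1, h2⟩ := H Finset.univ
    exact ⟨l, by simpa using hl, hs, fun i => h1 i (hGF (Finset.mem_univ i)),
      fun i j => h2 i (hGF (Finset.mem_univ i)) j (hGF (Finset.mem_univ j))⟩
  intro G
  induction G using Finset.induction_on with
  | empty =>
    refine ⟨[], by simp, by simp, {u, v}, by simp, by simp, by simp, x, hx, rfl, hxu, hxv, ?_, ?_⟩
    · simp [hxu, hxv]
    · simp [huv, huv.symm]
  | insert k G hkG ih =>
    obtain ⟨l, hl, hs, F, hu, hv, hGF, y, hy, hly, hyu, hyv, h1, h2⟩ := ih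
    rw [Finset.card_insert_of_notMem hkG]
    by_cases hk : k ∈ F
    · exact ⟨l, by omega, hs, F, hu, hv, Finset.insert_subset hk hGF, y, hy, hly, hyu, hyv, h1, h2⟩
    obtain ⟨l', hl', hs', z, hz, hzF, hlz⟩ :=
      exists_word_move_node hA hα0 hα1 hβ hsign hu hv hy hyu hyv h1 h2 hk
    have hne : ∀ k' ∈ F, k' ≠ k := fun k' h e => hk (e ▸ h)
    refine ⟨l ++ l', by rw [List.length_append]; omega, ?_, insert k F,
      Finset.mem_insert_of_mem hu, Finset.mem_insert_of_mem hv, Finset.insert_subset_insert k hGF,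
      Function.update y k z, update_mem_box hy k ?_, by rw [List.foldl_append, hly, hlz],
      by simp [hne u hu, hyu], by simp [hne v hv, hyv], ?_, ?_⟩
    · intro s hs1
      exact (List.mem_append.1 hs1).elim (hs s) (hs' s)
    · rcases hz with rfl | rfl <;> constructor <;> linarith
    · intro k' hk'
      rcases Finset.mem_insert.1 hk' with rfl | hk'
      · simpa using hz
      · simpa [hne k' hk'] using h1 k' hk'
    · intro k₁ hk₁ k₂ hk₂ hcl
      rcases Finset.mem_insert.1 hk₁ with e₁ | h₁ <;> rcases Finset.mem_insert.1 hk₂ with e₂ | h₂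
      · rw [e₁, e₂]
      · subst e₁
        simpa [hne k₂ h₂] using hzF k₂ h₂ hcl
      · subst e₂
        simpa [hne k₁ h₁] using (hzF k₁ h₁ hcl.symm).symm
      · simpa [hne k₁ h₁, hne k₂ h₂] using h2 k₁ h₁ k₂ h₂ hcl

/-- Two nodes of different clusters hold beliefs at least half the diameter apart. -/
lemma exists_cross_gap {n m : ℕ} [NeZero n] {cl : Fin n → Fin m} (hcl : ∀ i, ∃ k, cl k ≠ cl i)
    (x : Fin n → ℝ) : ∃ u v, cl u ≠ cl v ∧ diam x / 2 ≤ x u - x v := by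
  obtain ⟨p, q, hd, hpq⟩ := exists_diam_eq x
  have hd0 := (hpq p).1
  by_cases h : cl p = cl q
  · obtain ⟨k, hk⟩ := hcl p
    rcases le_total (diam x / 2) (x p - x k) with h' | h'
    · exact ⟨p, k, hk.symm, h'⟩
    · exact ⟨k, q, h ▸ hk, by linarith⟩
  · exact ⟨p, q, h, by linarith⟩

/-- From any nonconstant state a word of fixed length leads either to a clustered boundary state
or to a state whose diameter has grown by a factor proportional to `1 + β`. -/
lemma exists_word_clustered_or_diam_growth {n m : ℕ} [NeZero n] {cl : Fin n → Fin m}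
    (hcl : ∀ i, ∃ k, cl k ≠ cl i) {α β A : ℝ} (hA : 0 < A) (hα0 : 0 < α) (hα1 : α < 1)
    (hβ : 1 ≤ α * β) {Epst Eneg : Finset (Sym2 (Fin n))} (hsign : ClusterSigned cl α β Epst Eneg)
    {γ : ℝ} (hγ : 0 ≤ γ)
    (hstep : ∀ s, ∀ x ∈ box n A, γ * diam x ≤ diam (cstep α β A Epst Eneg s x))
    {x : Fin n → ℝ} (hx : x ∈ box n A) (hd : 0 < diam x) :
    ∃ l : List (Sel2 n), l.length = 2 * n + 1 ∧ (∀ s ∈ l, IsPairLetter s) ∧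
      (l.foldl (fun y s => cstep α β A Epst Eneg s y) x ∈ clustered cl A ∨
        γ ^ (2 * n) * ((1 + β) / 2) * diam x ≤
          diam (l.foldl (fun y s => cstep α β A Epst Eneg s y) x)) := by
  have hβ0 : 0 ≤ β := by nlinarith
  obtain ⟨u, v, huv, hgap⟩ := exists_cross_gap hcl x
  have hne : u ≠ v := fun h => huv (by rw [h])
  obtain ⟨s, hs, hsu, hsv⟩ := exists_letter_update_update α β A Epst Eneg hne x
  rw [hsign u v hne, if_neg huv] at hsu hsv
  set y := cstep α β A Epst Eneg s x with hy
  have hyb : y ∈ box n A := cstep_mem_box hA.le Epst Eneg s hx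
  by_cases hext : A ≤ (1 - -β) * x u + -β * x v ∧ (1 - -β) * x v + -β * x u ≤ -A
  · obtain ⟨l, hl, hls, hlc⟩ := exists_word_clustered hA hα0 hα1 hβ hsign huv hyb
      (hsu.trans (projA_of_le hA.le hext.1)) (hsv.trans (projA_of_le_neg hA.le hext.2))
    refine ⟨s :: (l ++ List.replicate (2 * n - l.length) s), ?_, ?_, Or.inl ?_⟩
    · simp only [List.length_cons, List.length_append, List.length_replicate]; omega
    · intro t ht
      simp only [List.mem_cons, List.mem_append, List.mem_replicate] at ht
      rcases ht with rfl | ht | ⟨-, rfl⟩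
      exacts [hs, hls t ht, hs]
    · rw [List.foldl_cons, List.foldl_append, foldl_of_mem_clustered hA.le hβ0 hsign hlc]
      exact hlc
  · refine ⟨s :: List.replicate (2 * n) s, by simp, ?_, Or.inr ?_⟩
    · intro t ht
      simp only [List.mem_cons, List.mem_replicate] at ht
      rcases ht with rfl | ⟨-, rfl⟩ <;> exact hs
    · have hpad := pow_mul_diam_le_foldl hγ
        (fun s x hx => cstep_mem_box (α := α) (β := β) hA.le Epst Eneg s hx) hstep
        (List.replicate (2 * n) s) y hyb
      rw [List.length_replicate] at hpad
      rw [List.foldl_cons]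
      refine le_trans ?_ hpad
      rw [mul_assoc]
      refine mul_le_mul_of_nonneg_left ?_ (pow_nonneg hγ _)
      have hyd := sub_le_diam y u v
      have hu1 : x u ≤ y u := hsu ▸ le_pull_neg hβ0 hx (by linarith)
      have hv1 : y v ≤ x v := hsv ▸ pull_neg_le hβ0 hx (by linarith)
      have hprod : β * (diam x / 2) ≤ β * (x u - x v) := mul_le_mul_of_nonneg_left hgap hβ0
      rw [not_and_or, not_le, not_le] at hext
      rcases hext with h | h
      · have : (1 - -β) * x u + -β * x v ≤ y u := by
          rw [hsu, pull, projA, min_eq_right h.le]; exact le_max_right _ _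
        nlinarith
      · have : y v ≤ (1 - -β) * x v + -β * x u := by
          rw [hsv, pull, projA]; exact max_le h.le (min_le_right _ _)
        nlinarith

/-! ### Almost sure clustering -/

open Classical in
/-- A Lyapunov weight: a negative power of the diameter, killed at clustered boundary states. -/
def clusterWeight {n m : ℕ} (cl : Fin n → Fin m) (A σ : ℝ) (x : Fin n → ℝ) : ℝ :=
  if x ∈ clustered cl A then 0 else diam x ^ (-σ)

lemma clusterWeight_nonneg {n m : ℕ} (cl : Fin n → Fin m) (A σ : ℝ) {x : Fin n → ℝ}
    (hx : 0 ≤ diam x) : 0 ≤ clusterWeight cl A σ x := by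
  rw [clusterWeight]
  split_ifs
  · exact le_rfl
  · exact Real.rpow_nonneg hx _

lemma clusterWeight_le {n m : ℕ} {cl : Fin n → Fin m} {A σ κ : ℝ} (hσ : 0 ≤ σ) (hκ : 0 < κ)
    {x y : Fin n → ℝ} (hx : 0 < diam x) (hxy : x ∈ clustered cl A → y ∈ clustered cl A)
    (h : y ∈ clustered cl A ∨ κ * diam x ≤ diam y) :
    clusterWeight cl A σ y ≤ κ ^ (-σ) * clusterWeight cl A σ x := by
  by_cases hy : y ∈ clustered cl A
  · rw [clusterWeight, if_pos hy]
    exact mul_nonneg (Real.rpow_nonneg hκ.le _) (clusterWeight_nonneg _ _ _ hx.le)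
  · rw [clusterWeight, if_neg hy, clusterWeight, if_neg fun hx' => hy (hxy hx'),
      ← Real.mul_rpow hκ.le hx.le]
    exact Real.rpow_le_rpow_of_nonpos (mul_pos hκ hx) (h.resolve_left hy) (by linarith)

lemma one_le_mul_clusterWeight {n m : ℕ} [NeZero n] {cl : Fin n → Fin m} {A σ : ℝ} (hσ : 0 ≤ σ)
    {x : Fin n → ℝ} (hx : x ∈ box n A) (hd : 0 < diam x) (hD : x ∉ clustered cl A) :
    1 ≤ (2 * A) ^ σ * clusterWeight cl A σ x := by
  rw [clusterWeight, if_neg hD, Real.rpow_neg hd.le, ← div_eq_mul_inv,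
    one_le_div (Real.rpow_pos_of_pos hd _)]
  exact Real.rpow_le_rpow hd.le (diam_le_of_mem_box hx) hσ

lemma pow_length_le_prod_map {S : Type*} {q : S → ℝ} {p : ℝ} (hp : 0 ≤ p) (l : List S)
    (h : ∀ s ∈ l, p ≤ q s) : p ^ l.length ≤ (l.map q).prod := by
  induction l with
  | nil => simp
  | cons s l ih =>
    rw [List.length_cons, pow_succ', List.map_cons, List.prod_cons]
    have hs := h s (by simp)
    exact mul_le_mul hs (ih fun t ht => h t (by simp [ht])) (pow_nonneg hp _) (hp.trans hs)

lemma cproc_eq_wordState {n : ℕ} (α β A : ℝ) (Epst Eneg : Finset (Sym2 (Fin n)))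
    (x0 : Fin n → ℝ) (ω : ℕ → Sel2 n) (k : ℕ) :
    cproc α β A Epst Eneg x0 ω k = wordState (cstep α β A Epst Eneg) x0 k fun i => ω i := by
  induction k with
  | zero => rfl
  | succ k ih => simp [cproc, wordState, ih]

/-- If the growth of the diameter outweighs its possible contraction, then the constrained
process almost surely reaches a clustered boundary state. -/
lemma ae_exists_cproc_mem_clustered {n m : ℕ} [NeZero n] {cl : Fin n → Fin m}
    (hcl : ∀ i, ∃ k, cl k ≠ cl i) {α β A : ℝ} (hA : 0 < A) (hα0 : 0 < α) (hα1 : α < 1)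
    (hβ : 1 ≤ α * β) {Epst Eneg : Finset (Sym2 (Fin n))} (hsign : ClusterSigned cl α β Epst Eneg)
    {μ : Measure (ℕ → Sel2 n)} [IsProbabilityMeasure μ] {q : Sel2 n → ℝ≥0∞}
    (hμ : ∀ (K : Finset ℕ) (v : ℕ → Sel2 n), μ {ω | ∀ k ∈ K, ω k = v k} = ∏ k ∈ K, q (v k))
    {p₀ : ℝ} (hp₀ : 0 ≤ p₀) (hp₀q : ∀ s, IsPairLetter s → p₀ ≤ (q s).toReal)
    {γ : ℝ} (hγ0 : 0 < γ)
    (hγ : ∀ s, ∀ x ∈ box n A, γ * diam x ≤ diam (cstep α β A Epst Eneg s x))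
    {σ : ℝ} (hσ : 0 < σ)
    (hρ : (1 - p₀ ^ (2 * n + 1)) * (γ ^ (-σ)) ^ (2 * n + 1) +
      (γ ^ (2 * n) * ((1 + β) / 2)) ^ (-σ) < 1)
    {x0 : Fin n → ℝ} (hx0 : x0 ∈ box n A) (hd0 : 0 < diam x0) :
    ∀ᵐ ω ∂μ, ∃ k, cproc α β A Epst Eneg x0 ω k ∈ clustered cl A := by
  have hβ0 : 0 ≤ β := by nlinarith
  simp only [cproc_eq_wordState]
  have hq : ∀ s, 0 ≤ (q s).toReal := fun s => ENNReal.toReal_nonneg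
  have hq1 := sum_toReal_eq_one hμ
  have hI : ∀ s, ∀ x ∈ {x : Fin n → ℝ | x ∈ box n A ∧ 0 < diam x},
      cstep α β A Epst Eneg s x ∈ {x : Fin n → ℝ | x ∈ box n A ∧ 0 < diam x} :=
    fun s x hx => ⟨cstep_mem_box hA.le Epst Eneg s hx.1,
      (mul_pos hγ0 hx.2).trans_le (hγ s x hx.1)⟩
  have hc : 0 ≤ γ ^ (-σ) := Real.rpow_nonneg hγ0.le _
  have hf : 0 < γ ^ (2 * n) * ((1 + β) / 2) := mul_pos (pow_pos hγ0 _) (by linarith)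
  have hw : ∀ s, ∀ x ∈ {x : Fin n → ℝ | x ∈ box n A ∧ 0 < diam x},
      clusterWeight cl A σ (cstep α β A Epst Eneg s x) ≤ γ ^ (-σ) * clusterWeight cl A σ x :=
    fun s x hx => clusterWeight_le hσ.le hγ0 hx.2
      (fun h => (cstep_of_mem_clustered hA.le hβ0 hsign h s).symm ▸ h) (Or.inr (hγ s x hx.1))
  have hdrift : ∀ x ∈ {x : Fin n → ℝ | x ∈ box n A ∧ 0 < diam x},
      (avgOp (fun s => (q s).toReal) (cstep α β A Epst Eneg))^[2 * n + 1]
        (clusterWeight cl A σ) x ≤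
      max 0 ((1 - p₀ ^ (2 * n + 1)) * (γ ^ (-σ)) ^ (2 * n + 1) +
      (γ ^ (2 * n) * ((1 + β) / 2)) ^ (-σ)) * clusterWeight cl A σ x := by
    intro x hx
    have hwx := clusterWeight_nonneg cl A σ hx.2.le
    refine le_trans ?_ (mul_le_mul_of_nonneg_right (le_max_right _ _) hwx)
    obtain ⟨l, hlen, hl, hlx⟩ :=
      exists_word_clustered_or_diam_growth hcl hA hα0 hα1 hβ hsign hγ0.le hγ hx.1 hx.2
    have h := iterate_avgOp_le_of_word hq hq1 hI hc hw l x hx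
    rw [hlen] at h
    have hpl := pow_length_le_prod_map hp₀ l fun s hs => hp₀q s (hl s hs)
    rw [hlen] at hpl
    have hpl1 := prod_map_le_one hq
      (fun s => hq1 ▸ Finset.single_le_sum (fun s _ => hq s) (Finset.mem_univ s)) l
    have hend : clusterWeight cl A σ (l.foldl (fun y s => cstep α β A Epst Eneg s y) x) ≤
        (γ ^ (2 * n) * ((1 + β) / 2)) ^ (-σ) * clusterWeight cl A σ x :=
      clusterWeight_le hσ.le hf hx.2
        (fun h => (foldl_of_mem_clustered hA.le hβ0 hsign h l).symm ▸ h) hlx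
    have hend0 : 0 ≤ (γ ^ (2 * n) * ((1 + β) / 2)) ^ (-σ) * clusterWeight cl A σ x :=
      mul_nonneg (Real.rpow_nonneg hf.le _) hwx
    refine h.trans ?_
    rw [add_mul]
    refine add_le_add ?_ ?_
    · exact mul_le_mul_of_nonneg_right
        (mul_le_mul_of_nonneg_right (by linarith) (pow_nonneg hc _)) hwx
    · exact (mul_le_mul_of_nonneg_left hend ((pow_nonneg hp₀ _).trans hpl)).trans
        (mul_le_of_le_one_left hend0 hpl1)
  exact ae_exists_mem_of_drift hμ hI (Real.rpow_nonneg (by linarith : 0 ≤ 2 * A) σ)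
    (le_max_left _ _) (max_lt one_pos hρ)
    (fun x hx => clusterWeight_nonneg cl A σ hx.2.le)
    (fun x hx hD => one_le_mul_clusterWeight hσ.le hx.1 hx.2 hD) hdrift ⟨hx0, hd0⟩

/-- Once a clustered boundary state is reached, every belief is eventually constant. -/
lemma tendsto_cproc_of_mem_clustered {n m : ℕ} {cl : Fin n → Fin m} {α β A : ℝ} (hA : 0 ≤ A)
    (hβ : 0 ≤ β) {Epst Eneg : Finset (Sym2 (Fin n))} (hsign : ClusterSigned cl α β Epst Eneg)
    {x0 : Fin n → ℝ} {ω : ℕ → Sel2 n} {k : ℕ}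
    (hk : cproc α β A Epst Eneg x0 ω k ∈ clustered cl A) (i : Fin n) :
    Tendsto (fun j => cproc α β A Epst Eneg x0 ω j i) atTop
      (nhds (cproc α β A Epst Eneg x0 ω k i)) := by
  have hconst : ∀ j, k ≤ j → cproc α β A Epst Eneg x0 ω j = cproc α β A Epst Eneg x0 ω k := by
    intro j hj
    induction j, hj using Nat.le_induction with
    | base => rfl
    | succ j hj ih => rw [cproc, ih, cstep_of_mem_clustered hA hβ hsign hk]
  refine tendsto_const_nhds.congr' ?_
  filter_upwards [eventually_ge_atTop k] with j hj
  rw [hconst j hj]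

lemma exists_pos_le_seldist2 {n : ℕ} {P : Matrix (Fin n) (Fin n) ℝ} {E : Finset (Sym2 (Fin n))}
    (hE : ∀ i j : Fin n, i ≠ j → s(i, j) ∈ E) (hP : ∀ i j : Fin n, s(i, j) ∈ E → 0 < P i j + P j i)
    {a b c : ℝ} (ha : 0 < a) (hb : 0 < b) (hc : 0 < c) :
    ∃ p : ℝ, 0 < p ∧ ∀ s, IsPairLetter s → p ≤ (seldist2 P E a b c s).toReal := by
  classical
  have hpos : ∀ s, IsPairLetter s → 0 < (seldist2 P E a b c s).toReal := by
    rintro _ ⟨i, j, t, hij, rfl⟩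
    have hmem := hE i j hij.ne
    have hw : 0 < edgeWeight P s(i, j) :=
      div_pos (hP i j hmem) (Nat.cast_pos.2 i.pos)
    have ht : 0 < wabc a b c t := by fin_cases t <;> simpa [wabc]
    rw [seldist2, if_pos ⟨hij, hmem⟩, ENNReal.toReal_mul, ENNReal.toReal_ofReal ht.le,
      ENNReal.toReal_ofReal hw.le]
    exact mul_pos ht hw
  by_cases hne : (Finset.univ.filter fun s : Sel2 n => IsPairLetter s).Nonempty
  · obtain ⟨s₀, hs₀, hmin⟩ := Finset.exists_min_image _
      (fun s => (seldist2 P E a b c s).toReal) hne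
    exact ⟨_, hpos s₀ (by simpa using hs₀), fun s hs => hmin s (by simpa using hs)⟩
  · rw [Finset.not_nonempty_iff_eq_empty, Finset.filter_eq_empty_iff] at hne
    exact ⟨1, one_pos, fun s hs => absurd hs (hne (Finset.mem_univ s))⟩

/-- For a small enough exponent, a negative power of the contraction factor is beaten by the
probability `p`, and the remaining margin is reached for all large `β`. -/
lemma exists_exponent_threshold {p γ δ : ℝ} (hp : 0 < p) (hγ : 0 < γ) (hδ : 0 < δ) (N : ℕ) :
    ∃ σ : ℝ, 0 < σ ∧ ∀ᶠ β : ℝ in atTop,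
      (1 - p) * (γ ^ (-σ)) ^ N + (δ * ((1 + β) / 2)) ^ (-σ) < 1 := by
  have hcont : Continuous fun σ : ℝ => (1 - p) * (γ ^ (-σ)) ^ N :=
    continuous_const.mul
      (((Real.continuous_const_rpow hγ.ne').comp continuous_neg).pow N)
  have hlim : Tendsto (fun σ : ℝ => (1 - p) * (γ ^ (-σ)) ^ N) (nhds 0) (nhds (1 - p)) := by
    simpa using hcont.tendsto 0
  have hev := (hlim.mono_left (nhdsWithin_le_nhds (s := Set.Ioi 0))).eventually_lt_const (u := 1) (by linarith)
  obtain ⟨σ, hσ, hσ0⟩ := (hev.and self_mem_nhdsWithin).exists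
  refine ⟨σ, hσ0, ?_⟩
  have hgrow : Tendsto (fun β : ℝ => δ * ((1 + β) / 2)) atTop atTop :=
    ((tendsto_atTop_add_const_left _ 1 tendsto_id).atTop_div_const two_pos).const_mul_atTop hδ
  have hsum := ((tendsto_rpow_neg_atTop hσ0).comp hgrow).const_add ((1 - p) * (γ ^ (-σ)) ^ N)
  rw [add_zero] at hsum
  exact hsum.eventually_lt_const hσ


theorem boundary_clustering_weak_balance_complete
    (n : ℕ) (hn : 3 ≤ n)
    (Epst Eneg : Finset (Sym2 (Fin n)))
    (hdisj : Disjoint Epst Eneg)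
    (hloop : ∀ e ∈ Epst ∪ Eneg, ¬ e.IsDiag)
    (P : Matrix (Fin n) (Fin n) ℝ)
    (hP : RowStochastic P)
    (hPc : Complies P (Epst ∪ Eneg))
    (hcomplete : ∀ i j : Fin n, i ≠ j → s(i, j) ∈ Epst ∪ Eneg)
    (hneg : Eneg.Nonempty)
    (hpw : ∀ i j : Fin n, s(i, j) ∈ Epst ∪ Eneg → 0 < P i j + P j i)
    (m : ℕ) (hm : 2 ≤ m)
    (Vp : Fin m → Finset (Fin n))
    (hVne : ∀ l : Fin m, (Vp l).Nonempty)
    (hVdisj : ∀ l1 l2 : Fin m, l1 ≠ l2 → Disjoint (Vp l1) (Vp l2))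
    (hVcover : ∀ i : Fin n, ∃ l : Fin m, i ∈ Vp l)
    (hbal1 : ∀ i j : Fin n, i ≠ j → (∃ l : Fin m, i ∈ Vp l ∧ j ∈ Vp l) → s(i, j) ∈ Epst)
    (hbal2 : ∀ i j : Fin n, i ≠ j → (∀ l : Fin m, ¬ (i ∈ Vp l ∧ j ∈ Vp l)) → s(i, j) ∈ Eneg)
    (hind : ∀ l : Fin m, ((graphOf (Epst ∪ Eneg)).induce (↑(Vp l) : Set (Fin n))).Connected)
    (α : ℝ) (hα0 : 0 < α) (hα1 : α < 1) (hαhalf : α ≠ 1 / 2)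
    (A : ℝ) (hA : 0 < A)
    (a b c : ℝ) (ha : 0 < a) (hb : 0 < b) (hc : 0 < c) (habc : a + b + c = 1)
    (ℙ : Measure (ℕ → Sel2 n)) [IsProbabilityMeasure ℙ]
    (hiid : IsIIDSel2 ℙ P (Epst ∪ Eneg) a b c) :
    ∃ β0 : ℝ, 0 < β0 ∧ ∀ β : ℝ, β0 < β →
      ∀ x0 : Fin n → ℝ, (∀ i, x0 i ∈ Set.Icc (-A) A) → 0 < diam x0 →
        ∃ B : Fin m → (ℕ → Sel2 n) → ℝ,
          (∀ l ω, B l ω = A ∨ B l ω = -A) ∧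
          ℙ {ω | ∀ l : Fin m, ∀ i ∈ Vp l,
            Tendsto (fun k : ℕ => cproc α β A Epst Eneg x0 ω k i) atTop (nhds (B l ω))} = 1 := by
  have : NeZero n := ⟨by omega⟩
  choose cl hcl using hVcover
  have hmem : ∀ i l, i ∈ Vp l → cl i = l := fun i l hi => by
    by_contra h
    exact Finset.disjoint_left.1 (hVdisj _ _ h) (hcl i) hi
  have hclne : ∀ i, ∃ k, cl k ≠ cl i := by
    intro i
    have : Nontrivial (Fin m) := Fin.nontrivial_iff_two_le.2 hm
    obtain ⟨l, hl⟩ := exists_ne (cl i)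
    obtain ⟨k, hk⟩ := hVne l
    exact ⟨k, by rwa [hmem k l hk]⟩
  have hsign : ∀ β, ClusterSigned cl α β Epst Eneg := by
    intro β i j hij
    rw [theta]
    split_ifs with h1 h2 h3 h4 h5
    · rfl
    · refine absurd (hbal2 i j hij fun l hl => h2 ?_) (Finset.disjoint_left.1 hdisj h1)
      rw [hmem i l hl.1, hmem j l hl.2]
    · exact absurd (hbal1 i j hij ⟨cl i, hcl i, h4 ▸ hcl j⟩) h1
    · rfl
    · exact absurd (hbal1 i j hij ⟨cl i, hcl i, h5 ▸ hcl j⟩) h1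
    · exact absurd (Finset.mem_union.1 (hcomplete i j hij)) (by tauto)
  obtain ⟨p₀, hp₀, hp₀q⟩ := exists_pos_le_seldist2 hcomplete hpw ha hb hc
  have hγ0 : 0 < min (1 - α) (|1 - 2 * α| / 2) := by
    refine lt_min (by linarith) (half_pos (abs_pos.2 fun h => hαhalf ?_))
    linarith
  obtain ⟨σ, hσ, hev⟩ := exists_exponent_threshold (pow_pos hp₀ (2 * n + 1)) hγ0
    (pow_pos hγ0 (2 * n)) (2 * n + 1)
  obtain ⟨β₁, hβ₁⟩ := eventually_atTop.1 hev
  refine ⟨max (1 / α) β₁, lt_max_of_lt_left (by positivity), fun β hβ x0 hx0 hd0 => ?_⟩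
  have hαβ : 1 ≤ α * β := by
    have h := (le_max_left _ _).trans hβ.le
    rwa [div_le_iff₀' hα0] at h
  have hβ0 : 0 ≤ β := by nlinarith
  have hae := ae_exists_cproc_mem_clustered hclne hA hα0 hα1 hαβ (hsign β) hiid hp₀.le hp₀q hγ0
    (fun s x hx => diam_cstep hα0.le hα1.le hβ0
      (fun i j hij => by rw [hsign β i j hij]; split_ifs <;> simp) s hx)
    hσ (hβ₁ β ((le_max_right _ _).trans hβ.le)) hx0 hd0
  choose r hr using hVne
  classical
  refine ⟨fun l ω => if Tendsto (fun k => cproc α β A Epst Eneg x0 ω k (r l)) atTop (nhds A)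
    then A else -A, fun l ω => ?_, ?_⟩
  · dsimp only
    split_ifs <;> simp
  · rw [← measure_univ (μ := ℙ)]
    refine measure_congr (eventuallyEq_univ.2 ?_)
    filter_upwards [hae] with ω hω l i hi
    obtain ⟨k, hk⟩ := hω
    have hlim := tendsto_cproc_of_mem_clustered hA.le hβ0 (hsign β) hk
    have hri := hlim (r l)
    have hii := hlim i
    rw [hk.2 i (r l) ((hmem i l hi).trans (hmem _ l (hr l)).symm)] at hii
    rcases hk.1 (r l) with e | e <;> rw [e] at hri hii
    · rwa [if_pos hri]
    · rwa [if_neg fun h => by linarith [tendsto_nhds_unique h hri]]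

end SignedOpinion
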